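/- arXiv:2306.05054 — 3 statements merged into one kernel-verified Lean document; each statement's English description precedes it below -/
import Mathlib

section
/- Let α be a fixed real with 1/6 ≤ α ≤ (52 − 16√3)/121, and set p = (1 − √(α(3 − 2α)))/(1 − 2α). For every η > 0 there exists n₀ such that for all integers n ≥ n₀ there is a simple graph R on N = ⌊(3/(1 + 2p²) − η)·n⌋ vertices such that R contains no book B_{⌈αn⌉} and the complement of R contains no book B_n. Consequently, r(B_{⌈αn⌉}, B_n) ≥ 3n/(1 + 2p²) − o(n). -/
/-- A simple graph `G` contains the book `B_m`: two adjacent vertices with at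
least `m` common neighbors. -/
def HasBook {V : Type*} (G : SimpleGraph V) (m : ℕ) : Prop :=
  ∃ u v : V, G.Adj u v ∧ m ≤ ({w | G.Adj u w ∧ G.Adj v w} : Set V).ncard

open MeasureTheory ProbabilityTheory Filter

/-- Hoeffding upper tail for the number of independent events that occur. -/
lemma measureReal_le_ncard_of_iIndepSet {Ω ι : Type*} [MeasurableSpace Ω] {μ : Measure Ω}
    [IsProbabilityMeasure μ] [Fintype ι] {A : ι → Set Ω} (hA : ∀ i, MeasurableSet (A i))
    (hind : iIndepSet A μ) {r ε k : ℝ} (hr0 : 0 ≤ r) (hr : ∀ i, μ.real (A i) ≤ r)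
    (hε : 0 < ε) (hk0 : 0 < k) (hk : (Fintype.card ι : ℝ) ≤ k) :
    μ.real {ω | (r + ε) * k ≤ (({i | ω ∈ A i} : Set ι).ncard : ℝ)} ≤
      Real.exp (-(2 * ε ^ 2 * k)) := by
  classical
  set X : ι → Ω → ℝ := fun i => (A i).indicator fun _ => 1 with hX
  have hint (i) : μ[X i] = μ.real (A i) := by
    simp [hX, integral_indicator (hA i)]
  have hsub (i) : HasSubgaussianMGF (fun ω => X i ω - μ[X i]) ((‖(1 : ℝ) - 0‖₊ / 2) ^ 2) μ := by
    refine hasSubgaussianMGF_of_mem_Icc ((measurable_const.indicator (hA i)).aemeasurable) ?_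
    refine ae_of_all _ fun ω => ?_
    by_cases h : ω ∈ A i <;> simp [hX, h]
  have hindX : iIndepFun (fun i ω => X i ω - μ[X i]) μ :=
    (hind.iIndepFun_indicator (β := ℝ)).comp (fun (i : ι) (x : ℝ) => x - ∫ ω, X i ω ∂μ)
      fun i => measurable_id.sub_const _
  have hH := HasSubgaussianMGF.measure_sum_ge_le_of_iIndepFun hindX
    (s := Finset.univ) (fun i _ => hsub i) (ε := ε * k) (by positivity)
  have hcount (ω) : (({i | ω ∈ A i} : Set ι).ncard : ℝ) = ∑ i, X i ω := by
    rw [Set.ncard_eq_toFinset_card']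
    simp [hX, Set.indicator_apply]
  rcases isEmpty_or_nonempty ι with hι | hι
  · have : {ω | (r + ε) * k ≤ (({i | ω ∈ A i} : Set ι).ncard : ℝ)} = ∅ := by
      ext ω
      have : 0 < (r + ε) * k := by positivity
      simp [hcount, this]
    rw [this]
    simp [Real.exp_nonneg]
  have hcard : (0 : ℝ) < Fintype.card ι := by exact_mod_cast Fintype.card_pos
  refine (measureReal_mono ?_).trans (hH.trans ?_)
  · intro ω hω
    simp only [Set.mem_ofPred_eq, hcount] at hω ⊢
    have h1 : ∑ i, μ[X i] ≤ r * k := by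
      calc ∑ i, μ[X i] ≤ ∑ _i : ι, r := Finset.sum_le_sum fun i _ => by rw [hint]; exact hr i
        _ = r * Fintype.card ι := by simp [mul_comm]
        _ ≤ r * k := by gcongr
    rw [Finset.sum_sub_distrib]
    linarith
  · rw [Real.exp_le_exp]
    have : ((∑ i : ι, (‖(1 : ℝ) - 0‖₊ / 2) ^ 2 : NNReal) : ℝ) = Fintype.card ι / 4 := by
      simp; ring
    rw [this, neg_div, neg_le_neg_iff, le_div_iff₀ (by positivity)]
    have : ε ^ 2 * k * Fintype.card ι ≤ ε ^ 2 * k * k := by gcongr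
    linarith

/-- Under a product measure, cylinder events depending on disjoint sets of coordinates are
independent. -/
lemma iIndepSet_pi_of_pairwiseDisjoint {ι E β : Type*} [Fintype E] [DecidableEq E]
    [MeasurableSpace β] [MeasurableSingletonClass β] (μ : Measure β) [IsProbabilityMeasure μ]
    (c : β) {T : ι → Finset E} (hT : Pairwise fun i j => Disjoint (T i) (T j)) :
    iIndepSet (fun i => (T i : Set E).pi fun _ => {c}) (Measure.pi fun _ : E => μ) := by
  rw [iIndepSet_iff_meas_biInter
    fun i => MeasurableSet.pi (Finset.countable_toSet _) fun _ _ => measurableSet_singleton c]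
  intro s
  have : ⋂ i ∈ s, (T i : Set E).pi (fun _ => ({c} : Set β)) =
      ((s.biUnion T : Finset E) : Set E).pi fun _ => {c} := by
    ext ω
    simp only [Set.mem_iInter, Set.mem_pi, Finset.mem_coe, Finset.mem_biUnion]
    grind
  rw [this]
  simp only [Measure.pi_pi_finset]
  rw [Finset.prod_biUnion fun i _ j _ h => hT h]

/-- The sets of edges joining `w` to `u` and `v` are disjoint for different `w`, one of which
is not in `{u, v}`. -/
lemma disjoint_edges {V : Type*} [DecidableEq V] {u v w w' : V} (hw : w ≠ u ∧ w ≠ v)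
    (h : w ≠ w') :
    Disjoint ({s(u, w), s(v, w)} : Finset (Sym2 V)) {s(u, w'), s(v, w')} := by
  rw [Finset.disjoint_left]
  simp only [Finset.mem_insert, Finset.mem_singleton]
  rintro e (rfl | rfl) <;> simp only [Sym2.eq_iff] <;> grind

lemma eventually_sq_mul_exp_lt_one (C : ℝ) {a : ℝ} (ha : 0 < a) :
    ∀ᶠ k : ℕ in atTop, C * (k : ℝ) ^ 2 * Real.exp (-(a * k)) < 1 := by
  have h := (Real.tendsto_pow_mul_exp_neg_atTop_nhds_zero 2).comp
    (tendsto_natCast_atTop_atTop.const_mul_atTop ha)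
  have h2 := (h.const_mul (C / a ^ 2))
  rw [mul_zero] at h2
  filter_upwards [h2.eventually_lt_const one_pos] with k hk
  have : C / a ^ 2 * ((a * k) ^ 2 * Real.exp (-(a * k))) = C * (k : ℝ) ^ 2 * Real.exp (-(a * k)) := by
    field_simp
  exact this ▸ hk

/-- A random `2`-coloring of the pairs of `Fin 3 × Fin k` in which `true` has density `p`: degrees
and codegrees into each part, in either color, do not significantly exceed their expectations. -/
lemma exists_quasirandom_coloring (p : unitInterval) {ε : ℝ} (hε : 0 < ε) :
    ∀ᶠ k : ℕ in atTop, ∃ f : Sym2 (Fin 3 × Fin k) → Bool, ∀ u v i c,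
      (({w | w.1 = i ∧ (w ≠ u ∧ w ≠ v) ∧ f s(u, w) = c ∧ f s(v, w) = c} :
        Set (Fin 3 × Fin k)).ncard : ℝ) <
        ((bif c then (p : ℝ) else 1 - p) ^ (if u = v then 1 else 2) + ε) * k := by
  filter_upwards [eventually_sq_mul_exp_lt_one 54 (a := 2 * ε ^ 2) (by positivity),
    eventually_gt_atTop 0] with k hk hk0
  classical
  let V := Fin 3 × Fin k
  let μ : Measure Bool := bernoulliMeasure true false p
  let P : Measure (Sym2 V → Bool) := Measure.pi fun _ => μ
  let b : Bool → ℝ := fun c => bif c then (p : ℝ) else 1 - p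
  have hb (c) : μ.real {c} = b c := by
    simp only [μ, b]
    rw [bernoulliMeasure_real_apply _ (measurableSet_singleton c)]
    cases c <;> simp
  let S (q : V × V × Fin 3 × Bool) (f : Sym2 V → Bool) : Set V :=
    {w | w.1 = q.2.2.1 ∧ (w ≠ q.1 ∧ w ≠ q.2.1) ∧ f s(q.1, w) = q.2.2.2 ∧ f s(q.2.1, w) = q.2.2.2}
  let Bad (q : V × V × Fin 3 × Bool) : Set (Sym2 V → Bool) :=
    {f | (b q.2.2.2 ^ (if q.1 = q.2.1 then 1 else 2) + ε) * k ≤ ((S q f).ncard : ℝ)}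
  have hbad (q) : P.real (Bad q) ≤ Real.exp (-(2 * ε ^ 2 * k)) := by
    obtain ⟨u, v, i, c⟩ := q
    let ι := {w : V // w.1 = i ∧ (w ≠ u ∧ w ≠ v)}
    let T : ι → Finset (Sym2 V) := fun w => {s(u, w.1), s(v, w.1)}
    have hT : Pairwise fun i j => Disjoint (T i) (T j) := fun w w' h =>
      disjoint_edges w.2.2 (Subtype.coe_injective.ne h)
    have hTc (w : ι) : (T w).card = if u = v then 1 else 2 := by
      split_ifs with h
      · simp [T, h]
      · refine Finset.card_pair fun he => h ?_
        rw [Sym2.eq_iff] at he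
        grind
    have hmem (f : Sym2 V → Bool) (w : ι) :
        f ∈ (T w : Set (Sym2 V)).pi (fun _ => ({c} : Set Bool)) ↔
          f s(u, w.1) = c ∧ f s(v, w.1) = c := by
      simp [T]
    have hcard : Fintype.card ι ≤ k := by
      refine (Fintype.card_le_of_injective (fun w : ι => w.1.2) ?_).trans (Fintype.card_fin k).le
      intro w w' h
      exact Subtype.ext (Prod.ext (w.2.1.trans w'.2.1.symm) h)
    have key := measureReal_le_ncard_of_iIndepSet (μ := P)
      (A := fun w => (T w : Set (Sym2 V)).pi fun _ => {c}) (r := b c ^ (if u = v then 1 else 2))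
      (k := k) (fun w => MeasurableSet.pi (Finset.countable_toSet _)
        fun _ _ => measurableSet_singleton c)
      (iIndepSet_pi_of_pairwiseDisjoint μ c hT) (pow_nonneg (hb c ▸ measureReal_nonneg) _)
      (fun w => by
        rw [measureReal_def, Measure.pi_pi_finset, Finset.prod_const, hTc, ENNReal.toReal_pow,
          ← measureReal_def, hb]) hε (by exact_mod_cast hk0) (by exact_mod_cast hcard)
    refine le_trans (measureReal_mono ?_) key
    intro f hf
    refine (show _ ≤ ((S (u, v, i, c) f).ncard : ℝ) from hf).trans ?_
    rw [← Set.ncard_image_of_injective _ (Subtype.val_injective (p := fun w : V =>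
      w.1 = i ∧ (w ≠ u ∧ w ≠ v)))]
    refine Nat.cast_le.2 (Set.ncard_le_ncard ?_ (Set.toFinite _))
    intro w hw
    exact ⟨⟨w, hw.1, hw.2.1⟩, (hmem f _).2 hw.2.2, rfl⟩
  have hunion : P.real (⋃ q, Bad q) < 1 := by
    calc P.real (⋃ q, Bad q) ≤ ∑ q, P.real (Bad q) := by
          simpa using measureReal_biUnion_finset_le (μ := P) Finset.univ Bad
      _ ≤ ∑ _q : V × V × Fin 3 × Bool, Real.exp (-(2 * ε ^ 2 * k)) :=
          Finset.sum_le_sum fun q _ => hbad q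
      _ = 54 * (k : ℝ) ^ 2 * Real.exp (-(2 * ε ^ 2 * k)) := by
          simp [V]; ring
      _ < 1 := hk
  obtain ⟨f, hf⟩ : ∃ f, f ∉ ⋃ q, Bad q := by
    by_contra! h
    rw [Set.eq_univ_of_forall h] at hunion
    simp at hunion
  refine ⟨f, fun u v i c => ?_⟩
  by_contra! h
  exact hf (Set.mem_iUnion.2 ⟨(u, v, i, c), h⟩)

lemma HasBook.of_injective {V W : Type*} [Finite W] {G : SimpleGraph V} {H : SimpleGraph W}
    {m : ℕ} {f : V → W} (hf : Function.Injective f) (hadj : ∀ u v, G.Adj u v → H.Adj (f u) (f v))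
    (h : HasBook G m) : HasBook H m := by
  obtain ⟨u, v, huv, hm⟩ := h
  refine ⟨f u, f v, hadj u v huv, hm.trans ?_⟩
  exact Set.ncard_le_ncard_of_injOn f (fun w hw => ⟨hadj _ _ hw.1, hadj _ _ hw.2⟩) hf.injOn
    (Set.toFinite _)

/-- The tripartite graph on `Fin 3 × Fin k` whose edges are the pairs between different parts that
`f` colors `false`. -/
def tripartiteGraph {k : ℕ} (f : Sym2 (Fin 3 × Fin k) → Bool) : SimpleGraph (Fin 3 × Fin k) where
  Adj u v := u.1 ≠ v.1 ∧ f s(u, v) = false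
  symm := ⟨fun u v h => ⟨h.1.symm, Sym2.eq_swap (a := u) (b := v) ▸ h.2⟩⟩
  loopless := ⟨fun _ h => h.1 rfl⟩

lemma compl_tripartiteGraph_adj {k : ℕ} {f : Sym2 (Fin 3 × Fin k) → Bool} {u v : Fin 3 × Fin k} :
    (tripartiteGraph f)ᶜ.Adj u v ↔ u ≠ v ∧ (u.1 = v.1 ∨ f s(u, v) = true) := by
  simp only [SimpleGraph.compl_adj, tripartiteGraph, ne_eq, not_and, Bool.not_eq_false]
  tauto

lemma ncard_part_le {k : ℕ} (i : Fin 3) (C : Set (Fin 3 × Fin k)) :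
    {w | w.1 = i ∧ w ∈ C}.ncard ≤ k := by
  have : {w | w.1 = i ∧ w ∈ C}.ncard ≤ (Set.univ : Set (Fin k)).ncard :=
    Set.ncard_le_ncard_of_injOn Prod.snd (fun _ _ => Set.mem_univ _)
      (fun w hw w' hw' h => Prod.ext (hw.1.trans hw'.1.symm) h) (Set.toFinite _)
  simpa using this

lemma ncard_le_add_parts {k : ℕ} {i j l : Fin 3} (h : ∀ x, x = i ∨ x = j ∨ x = l)
    (C : Set (Fin 3 × Fin k)) :
    (C.ncard : ℝ) ≤ {w | w.1 = i ∧ w ∈ C}.ncard + {w | w.1 = j ∧ w ∈ C}.ncard +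
      {w | w.1 = l ∧ w ∈ C}.ncard := by
  have hC : C ⊆ ({w | w.1 = i ∧ w ∈ C} ∪ {w | w.1 = j ∧ w ∈ C}) ∪ {w | w.1 = l ∧ w ∈ C} := by
    intro w hw
    rcases h w.1 with h | h | h <;> simp [h, hw]
  have h1 := Set.ncard_le_ncard hC (Set.toFinite _)
  have h2 := Set.ncard_union_le ({w | w.1 = i ∧ w ∈ C} ∪ {w | w.1 = j ∧ w ∈ C})
    {w | w.1 = l ∧ w ∈ C}
  have h3 := Set.ncard_union_le {w | w.1 = i ∧ w ∈ C} {w | w.1 = j ∧ w ∈ C}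
  exact_mod_cast h1.trans (h2.trans (by gcongr))

/-- For large `k`, some graph on `3k` vertices has all red books smaller than about `(1 - p)²k` and
all blue books smaller than about `(1 + 2p²)k`. -/
lemma exists_graph_not_hasBook (p : unitInterval) {ε : ℝ} (hε : 0 < ε) :
    ∀ᶠ k : ℕ in atTop, ∃ R : SimpleGraph (Fin 3 × Fin k), ∀ a b : ℕ,
      ((1 - (p : ℝ)) ^ 2 + ε) * k ≤ a → (1 + 2 * (p : ℝ) ^ 2 + 3 * ε) * k ≤ b →
        ¬ HasBook R a ∧ ¬ HasBook Rᶜ b := by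
  filter_upwards [exists_quasirandom_coloring p hε] with k ⟨f, hf⟩
  have sub {C : Set (Fin 3 × Fin k)} {u v i c}
      (h : ∀ w, w.1 = i → w ∈ C → (w ≠ u ∧ w ≠ v) ∧ f s(u, w) = c ∧ f s(v, w) = c) :
      ({w | w.1 = i ∧ w ∈ C}.ncard : ℝ) <
        ((bif c then (p : ℝ) else 1 - p) ^ (if u = v then 1 else 2) + ε) * k := by
    refine lt_of_le_of_lt ?_ (hf u v i c)
    rw [Nat.cast_le]
    refine Set.ncard_le_ncard ?_ (Set.toFinite _)
    exact fun w hw => ⟨hw.1, h w hw.1 hw.2⟩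
  refine ⟨tripartiteGraph f, fun a b ha hb => ⟨?_, ?_⟩⟩
  · rintro ⟨u, v, huv, hm⟩
    obtain ⟨l, hl⟩ : ∃ l : Fin 3, ∀ x, x ≠ u.1 → x ≠ v.1 → x = l := by
      have := huv.1
      revert this
      generalize u.1 = i
      generalize v.1 = j
      revert i j
      decide
    set C : Set (Fin 3 × Fin k) := {w | (tripartiteGraph f).Adj u w ∧ (tripartiteGraph f).Adj v w}
    have h1 := sub (C := C) (u := u) (v := v) (i := l) (c := false) fun w _ hw =>
      ⟨⟨hw.1.ne', hw.2.ne'⟩, hw.1.2, hw.2.2⟩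
    have h2 : {w | w.1 = l ∧ w ∈ C} = C := by
      ext w
      exact ⟨fun h => h.2, fun h => ⟨hl _ h.1.1.symm h.2.1.symm, h⟩⟩
    rw [h2, if_neg huv.ne] at h1
    have : (a : ℝ) ≤ C.ncard := by exact_mod_cast hm
    simp only [cond_false] at h1
    linarith
  · rintro ⟨u, v, huv, hm⟩
    set C : Set (Fin 3 × Fin k) :=
      {w | (tripartiteGraph f)ᶜ.Adj u w ∧ (tripartiteGraph f)ᶜ.Adj v w}
    have hm' : (b : ℝ) ≤ C.ncard := by exact_mod_cast hm
    have hthird {l : Fin 3} (hu : l ≠ u.1) (hv : l ≠ v.1) := sub (C := C) (u := u) (v := v)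
      (i := l) (c := true) fun w hwl hw => by
        simp only [C, Set.mem_ofPred_eq, compl_tripartiteGraph_adj] at hw
        grind
    simp only [if_neg huv.ne, cond_true] at hthird
    by_cases h : u.1 = v.1
    · obtain ⟨j, l, hj, hl, hx⟩ : ∃ j l : Fin 3, j ≠ u.1 ∧ l ≠ u.1 ∧
          ∀ x, x = u.1 ∨ x = j ∨ x = l := by
        generalize u.1 = i
        revert i
        decide
      have h1 := ncard_le_add_parts hx C
      have h2 : ({w | w.1 = u.1 ∧ w ∈ C}.ncard : ℝ) ≤ k := by
        exact_mod_cast ncard_part_le u.1 C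
      have h3 := hthird hj (h ▸ hj)
      have h4 := hthird hl (h ▸ hl)
      have : 0 ≤ ε * k := by positivity
      linarith
    · obtain ⟨l, hlu, hlv, hx⟩ : ∃ l : Fin 3, l ≠ u.1 ∧ l ≠ v.1 ∧
          ∀ x, x = u.1 ∨ x = v.1 ∨ x = l := by
        revert h
        generalize u.1 = i
        generalize v.1 = j
        revert i j
        decide
      have h1 := ncard_le_add_parts hx C
      have h2 := sub (C := C) (u := v) (v := v) (i := u.1) (c := true) fun w hwl hw => by
        simp only [C, Set.mem_ofPred_eq, compl_tripartiteGraph_adj] at hw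
        grind
      have h3 := sub (C := C) (u := u) (v := u) (i := v.1) (c := true) fun w hwl hw => by
        simp only [C, Set.mem_ofPred_eq, compl_tripartiteGraph_adj] at hw
        grind
      have h4 := hthird hlu hlv
      simp only [if_true, cond_true, pow_one] at h2 h3
      have : 0 ≤ (1 - (p : ℝ)) ^ 2 * k := by positivity
      linarith

/-- `p` is the root in `[0, 1]` of `(1 - p)² = α(1 + 2p²)`. -/
lemma density_spec {α p : ℝ} (hα1 : 1 / 6 ≤ α) (hα2 : α ≤ (52 - 16 * Real.sqrt 3) / 121)
    (hp : p = (1 - Real.sqrt (α * (3 - 2 * α))) / (1 - 2 * α)) :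
    0 ≤ p ∧ p ≤ 1 ∧ (1 - p) ^ 2 = α * (1 + 2 * p ^ 2) := by
  have h3 : (1.7 : ℝ) ≤ Real.sqrt 3 := Real.le_sqrt_of_sq_le (by norm_num)
  have hα : α ≤ 1 / 4 := by linarith
  have hs : Real.sqrt (α * (3 - 2 * α)) ^ 2 = α * (3 - 2 * α) :=
    Real.sq_sqrt (by nlinarith)
  have hs0 := Real.sqrt_nonneg (α * (3 - 2 * α))
  set s := Real.sqrt (α * (3 - 2 * α))
  have hd : 0 < 1 - 2 * α := by linarith
  have hps : p * (1 - 2 * α) = 1 - s := by rw [hp]; field_simp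
  refine ⟨?_, ?_, ?_⟩
  · rw [hp]
    exact div_nonneg (by nlinarith) hd.le
  · rw [hp, div_le_one hd]
    nlinarith
  · have h : s = 1 - p * (1 - 2 * α) := by linarith
    rw [h] at hs
    have : (1 - 2 * α) * ((1 - p) ^ 2 - α * (1 + 2 * p ^ 2)) = 0 := by linear_combination hs
    rcases mul_eq_zero.1 this with h | h <;> linarith

/-- For `1/6 ≤ α ≤ (52 − 16√3)/121` and `p = (1 − √(α(3 − 2α)))/(1 − 2α)`,
`r(B_{⌈αn⌉}, B_n) ≥ 3n/(1 + 2p²) − o(n)`. -/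
theorem ramsey_book_lower_bound (α : ℝ) (hα1 : 1/6 ≤ α)
    (hα2 : α ≤ (52 - 16 * Real.sqrt 3) / 121)
    (p : ℝ) (hp : p = (1 - Real.sqrt (α * (3 - 2 * α))) / (1 - 2 * α))
    (η : ℝ) (hη : 0 < η) :
    ∃ n₀ : ℕ, ∀ n : ℕ, n₀ ≤ n →
      ∃ R : SimpleGraph (Fin ⌊(3 / (1 + 2 * p ^ 2) - η) * (n : ℝ)⌋₊),
        ¬ HasBook R ⌈α * (n : ℝ)⌉₊ ∧ ¬ HasBook Rᶜ n := by
  obtain ⟨hp0, hp1, hpα⟩ := density_spec hα1 hα2 hp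
  set D := 1 + 2 * p ^ 2 with hD
  have hD0 : 0 < D := by positivity
  obtain ⟨δ, hδ0, hδη, hδD⟩ : ∃ δ : ℝ, 0 < δ ∧ 3 * δ ≤ η ∧ δ < 1 / D := by
    refine ⟨min (η / 3) (1 / D / 2), by positivity, ?_, ?_⟩
    · linarith [min_le_left (η / 3) (1 / D / 2)]
    · have : 0 < 1 / D := by positivity
      linarith [min_le_right (η / 3) (1 / D / 2)]
  set ε := D ^ 2 * δ / 12 with hε
  have hε0 : 0 < ε := by positivity
  have hlim : Tendsto (fun n : ℕ => ⌈(1 / D - δ) * (n : ℝ)⌉₊) atTop atTop :=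
    tendsto_nat_ceil_atTop.comp
      (tendsto_natCast_atTop_atTop.const_mul_atTop (sub_pos.2 hδD))
  rw [← eventually_atTop]
  filter_upwards [hlim.eventually (exists_graph_not_hasBook ⟨p, hp0, hp1⟩ hε0),
    tendsto_natCast_atTop_atTop.eventually_ge_atTop (2 / δ)] with n hR hn
  set k := ⌈(1 / D - δ) * (n : ℝ)⌉₊
  obtain ⟨R, hR⟩ := hR
  have hk_le : (k : ℝ) ≤ (1 / D - δ / 2) * n := by
    have h1 := (Nat.ceil_lt_add_one
      (mul_nonneg (sub_pos.2 hδD).le (Nat.cast_nonneg n))).le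
    rw [div_le_iff₀ hδ0] at hn
    linarith
  have hDk : (D + 6 * ε) * k ≤ n := by
    calc (D + 6 * ε) * k ≤ (D + 6 * ε) * ((1 / D - δ / 2) * n) := by gcongr
      _ = (1 - (D * δ / 2) ^ 2) * n := by rw [hε]; field_simp; ring
      _ ≤ 1 * n := by gcongr; linarith [sq_nonneg (D * δ / 2)]
      _ = n := one_mul _
  have hεk : 0 ≤ ε * k := by positivity
  obtain ⟨hred, hblue⟩ := hR ⌈α * (n : ℝ)⌉₊ n
    (by
      refine le_trans ?_ (Nat.le_ceil _)
      have h1 := mul_le_mul_of_nonneg_left hDk (by linarith : 0 ≤ α)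
      have h2 := mul_le_mul_of_nonneg_right hα1 hεk
      simp only [hpα]
      linarith)
    (by simp only [← hD]; linarith)
  have hN : ⌊(3 / D - η) * (n : ℝ)⌋₊ ≤ 3 * k := by
    refine Nat.floor_le_of_le ?_
    have h1 := Nat.le_ceil ((1 / D - δ) * (n : ℝ))
    have h2 : (3 * δ) * n ≤ η * n := by gcongr
    push_cast
    calc (3 / D - η) * (n : ℝ) = 3 * (1 / D * n) - η * n := by ring
      _ ≤ 3 * k := by linarith
  let g : Fin ⌊(3 / D - η) * (n : ℝ)⌋₊ → Fin 3 × Fin k :=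
    fun x => finProdFinEquiv.symm (Fin.castLE hN x)
  have hg : Function.Injective g :=
    finProdFinEquiv.symm.injective.comp (Fin.castLE_injective hN)
  refine ⟨R.comap g, fun h => hred (h.of_injective (H := R) hg fun _ _ h => h),
    fun h => hblue (h.of_injective (H := Rᶜ) hg fun u v h => ?_)⟩
  rw [SimpleGraph.compl_adj] at h ⊢
  exact ⟨hg.ne h.1, h.2⟩
end

section
/- For every real α with 1/6 ≤ α < (52 − 16√3)/121, setting p = (1 − √(α(3 − 2α)))/(1 − 2α), one has 3/(1 + 2p²) > (√α + 1)². -/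
/-- For `1/6 ≤ α < (52 − 16√3)/121` and `p = (1 − √(α(3 − 2α)))/(1 − 2α)`,
one has `3/(1 + 2p²) > (√α + 1)²`. -/
theorem three_div_gt_random_bound (α : ℝ) (h1 : 1/6 ≤ α)
    (h2 : α < (52 - 16 * Real.sqrt 3) / 121)
    (p : ℝ) (hp : p = (1 - Real.sqrt (α * (3 - 2 * α))) / (1 - 2 * α)) :
    (Real.sqrt α + 1) ^ 2 < 3 / (1 + 2 * p ^ 2) := by
  obtain ⟨w, hw⟩ : ∃ w, w = Real.sqrt 3 := ⟨_, rfl⟩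
  have hw2 : w ^ 2 = 3 := by rw [hw]; exact Real.sq_sqrt (by norm_num)
  have hw0 : 0 ≤ w := hw ▸ Real.sqrt_nonneg 3
  rw [← hw] at h2
  have hw_lo : 1.73 < w := by nlinarith
  have hw_hi : w < 1.74 := by nlinarith
  have hα : α < 1 / 4 := by linarith
  have hd : 0 < 1 - 2 * α := by linarith
  obtain ⟨r, hr⟩ : ∃ r, r = Real.sqrt (α * (3 - 2 * α)) := ⟨_, rfl⟩
  have hr0 : 0 ≤ r := hr ▸ Real.sqrt_nonneg _
  have hr2 : r ^ 2 = α * (3 - 2 * α) := by rw [hr]; exact Real.sq_sqrt (by nlinarith)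
  rw [← hr] at hp
  have hpr : p * (1 - 2 * α) = 1 - r := by rw [hp]; field_simp
  have hp_lt : p < 1 := by
    have : 2 * α < r := by nlinarith
    rw [hp, div_lt_one hd]; linarith
  have hp_gt : 2 * w - 3 < p := by
    rw [hp, lt_div_iff₀ hd]
    have hα0 : 0 < (28 - 16 * w) - α * (43 - 24 * w) := by
      have := mul_pos (sub_pos.2 h2) (show 0 < 43 - 24 * w by linarith)
      linear_combination this + (384 / 121) * hw2
    have hsq : r ^ 2 < (1 - (2 * w - 3) * (1 - 2 * α)) ^ 2 := by
      have := mul_pos hd hα0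
      linear_combination this + hr2 - 4 * (1 - 2 * α) ^ 2 * hw2
    have := lt_of_pow_lt_pow_left₀ 2 (by nlinarith) hsq
    linarith
  have hrel : α * (1 + 2 * p ^ 2) = (1 - p) ^ 2 := by
    apply mul_left_cancel₀ hd.ne'
    linear_combination -hr2 - (p * (1 - 2 * α) - 1 - r) * hpr
  have hq : 0 < 1 + 2 * p ^ 2 := by positivity
  obtain ⟨q, hqdef⟩ : ∃ q, q = Real.sqrt (1 + 2 * p ^ 2) := ⟨_, rfl⟩
  have hq0 : 0 ≤ q := hqdef ▸ Real.sqrt_nonneg _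
  have hq2 : q ^ 2 = 1 + 2 * p ^ 2 := by rw [hqdef]; exact Real.sq_sqrt hq.le
  have hsq : Real.sqrt α * q = 1 - p := by
    rw [hqdef, ← Real.sqrt_mul (by linarith), hrel, Real.sqrt_sq (by linarith)]
  have hqlt : q < w - 1 + p := by
    apply lt_of_pow_lt_pow_left₀ 2 (by linarith)
    have := mul_pos (sub_pos.2 hp_gt) (sub_pos.2 hp_lt)
    linear_combination this + hq2 - hw2
  rw [lt_div_iff₀ hq, ← hq2, ← mul_pow, add_mul, hsq, one_mul, ← hw2]
  exact pow_lt_pow_left₀ (by linarith) (by linarith) two_ne_zero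
end

section
/- For all real numbers α and λ with 1/6 ≤ α ≤ 1/4 and 0 ≤ λ ≤ α/(3/2 + 3α), one has √((1 − λ)·λ) ≥ √((α/(3/2 + 3α) − λ)·λ) + √((1/(3/2 + 3α) − (1 − λ)/2)·(1 − λ)). In other words, the strict inequality √((1 − λ)λ) < √((α/(3/2 + 3α) − λ)λ) + √((1/(3/2 + 3α) − (1 − λ)/2)(1 − λ)) has no solution in this range. -/
/-- Scaling form of monotonicity of the square root. -/
lemma Real.sqrt_le_mul_sqrt_of_le_sq_mul {c x y : ℝ} (hc : 0 ≤ c) (h : x ≤ c ^ 2 * y) :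
    Real.sqrt x ≤ c * Real.sqrt y :=
  calc Real.sqrt x ≤ Real.sqrt (c ^ 2 * y) := Real.sqrt_le_sqrt h
    _ = c * Real.sqrt y := by rw [Real.sqrt_mul (sq_nonneg c), Real.sqrt_sq hc]


/-- The concluding inequality in the proof of the upper bound
`r(B_{αn}, B_n) ≤ (3/2 + 3α) n + o(n)`: for `1/6 ≤ α ≤ 1/4` and
`0 ≤ λ ≤ α/(3/2 + 3α)`,
`√((1 − λ)λ) ≥ √((α/(3/2 + 3α) − λ)λ) + √((1/(3/2 + 3α) − (1 − λ)/2)(1 − λ))`. -/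
theorem sqrt_inequality_no_solution (α lam : ℝ)
    (h1 : 1/6 ≤ α) (h2 : α ≤ 1/4)
    (h3 : 0 ≤ lam) (h4 : lam ≤ α / (3/2 + 3 * α)) :
    Real.sqrt ((α / (3/2 + 3 * α) - lam) * lam) +
      Real.sqrt ((1 / (3/2 + 3 * α) - (1 - lam) / 2) * (1 - lam)) ≤
    Real.sqrt ((1 - lam) * lam) := by
  have hd : 0 < 3/2 + 3 * α := by linarith
  have hs : 1 / (3/2 + 3 * α) = 2/3 - 2 * (α / (3/2 + 3 * α)) := by
    field_simp
    ring
  have ha : α / (3/2 + 3 * α) ≤ 1/9 := by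
    rw [div_le_iff₀ hd]
    linarith
  have ha' : 1/12 ≤ α / (3/2 + 3 * α) := by
    rw [le_div_iff₀ hd]
    linarith
  rw [hs]
  generalize α / (3/2 + 3 * α) = a at *
  rcases le_total lam (4 * a - 1/3) with h | h
  · have h0 : Real.sqrt ((2/3 - 2 * a - (1 - lam) / 2) * (1 - lam)) = 0 :=
      Real.sqrt_eq_zero_of_nonpos (mul_nonpos_of_nonpos_of_nonneg (by linarith) (by linarith))
    rw [h0, add_zero]
    exact Real.sqrt_le_sqrt (mul_le_mul_of_nonneg_right (by linarith) h3)
  · have hu : Real.sqrt ((a - lam) * lam) ≤ 0.289 * Real.sqrt ((1 - lam) * lam) := by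
      apply Real.sqrt_le_mul_sqrt_of_le_sq_mul (by norm_num)
      rw [← mul_assoc]
      exact mul_le_mul_of_nonneg_right (by linarith) h3
    have hv : Real.sqrt ((2/3 - 2 * a - (1 - lam) / 2) * (1 - lam)) ≤
        0.708 * Real.sqrt ((1 - lam) * lam) := by
      apply Real.sqrt_le_mul_sqrt_of_le_sq_mul (by norm_num)
      rw [mul_comm (1 - lam) lam, ← mul_assoc]
      exact mul_le_mul_of_nonneg_right (by linarith) (by linarith)
    linarith [Real.sqrt_nonneg ((1 - lam) * lam)]
end
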